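/- Let the strong stability hypotheses hold (there exists ε0 > 0 such that for every r ∈ B(τ, ε0) ∩ (ℝ⁺)^m and every λ ∈ ℂ with Re λ ≥ 0 the matrices λE − A0 − Σ_{i=1}^m A_i e^{−λr_i} and Uᵀ A0 V + Σ_{i=1}^m Uᵀ A_i V e^{−λr_i} are invertible, and the supremum over such λ and r of ‖(Uᵀ A0 V + Σ_{i=1}^m Uᵀ A_i V e^{−λr_i})^{−1}‖ is finite), and assume Uᵀ A0 V + Σ_{i=1}^m Uᵀ A_i V e^{−jθ_i} is invertible for all θ ∈ [0, 2π]^m. Fix ξ > ⦀T_a(j·, τ)⦀∞. Then there exist real numbers ε > 0 and Ω > 0 and an integer N such that for any r ∈ B(τ, ε) ∩ (ℝ⁺)^m, the set of frequencies ω ∈ ℝ for which ξ is a singular value of T(jω, r) is finite with cardinality smaller than N, and every such ω satisfies |ω| < Ω. -/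

import Mathlib

open Matrix

/-- largest singular value (= L2 operator norm) of a complex matrix. -/
noncomputable def sigma1 {p q : ℕ} (M : Matrix (Fin p) (Fin q) ℂ) : ℝ :=
  ‖LinearMap.toContinuousLinearMap (Matrix.toEuclideanLin M)‖

/-- characteristic matrix λE − A0 − Σ_i A_i e^{−λ r_i}. -/
noncomputable def Delta {n m : ℕ} (E A0 : Matrix (Fin n) (Fin n) ℝ)
    (A : Fin m → Matrix (Fin n) (Fin n) ℝ) (r : Fin m → ℝ) (lam : ℂ) :
    Matrix (Fin n) (Fin n) ℂ :=
  lam • E.map Complex.ofReal - A0.map Complex.ofReal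
    - ∑ i, Complex.exp (-lam * (r i : ℂ)) • (A i).map Complex.ofReal

/-- transfer function T(λ, r) = C (λE − A0 − Σ A_i e^{−λ r_i})⁻¹ B. -/
noncomputable def Ttf {n m n_w n_z : ℕ} (E A0 : Matrix (Fin n) (Fin n) ℝ)
    (A : Fin m → Matrix (Fin n) (Fin n) ℝ)
    (B : Matrix (Fin n) (Fin n_w) ℝ) (C : Matrix (Fin n_z) (Fin n) ℝ)
    (r : Fin m → ℝ) (lam : ℂ) : Matrix (Fin n_z) (Fin n_w) ℂ :=
  C.map Complex.ofReal * (Delta E A0 A r lam)⁻¹ * B.map Complex.ofReal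

/-- Uᵀ A0 V + Σ_i Uᵀ A_i V e^{−λ r_i}. -/
noncomputable def DeltaA {n m ν : ℕ} (A0 : Matrix (Fin n) (Fin n) ℝ)
    (A : Fin m → Matrix (Fin n) (Fin n) ℝ)
    (U V : Matrix (Fin n) (Fin ν) ℝ) (r : Fin m → ℝ) (lam : ℂ) :
    Matrix (Fin ν) (Fin ν) ℂ :=
  (Uᵀ * A0 * V).map Complex.ofReal
    + ∑ i, Complex.exp (-lam * (r i : ℂ)) • (Uᵀ * A i * V).map Complex.ofReal

/-- asymptotic transfer function T_a(λ, r) = −CV (Uᵀ A0 V + Σ Uᵀ A_i V e^{−λ r_i})⁻¹ Uᵀ B. -/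
noncomputable def Ta {n m ν n_w n_z : ℕ} (A0 : Matrix (Fin n) (Fin n) ℝ)
    (A : Fin m → Matrix (Fin n) (Fin n) ℝ)
    (B : Matrix (Fin n) (Fin n_w) ℝ) (C : Matrix (Fin n_z) (Fin n) ℝ)
    (U V : Matrix (Fin n) (Fin ν) ℝ) (r : Fin m → ℝ) (lam : ℂ) :
    Matrix (Fin n_z) (Fin n_w) ℂ :=
  -((C * V).map Complex.ofReal * (DeltaA A0 A U V r lam)⁻¹ * (Uᵀ * B).map Complex.ofReal)

/-- Uᵀ A0 V + Σ_i Uᵀ A_i V e^{−jθ_i}. -/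
noncomputable def ABar {n m ν : ℕ} (A0 : Matrix (Fin n) (Fin n) ℝ)
    (A : Fin m → Matrix (Fin n) (Fin n) ℝ)
    (U V : Matrix (Fin n) (Fin ν) ℝ) (θ : Fin m → ℝ) :
    Matrix (Fin ν) (Fin ν) ℂ :=
  (Uᵀ * A0 * V).map Complex.ofReal
    + ∑ i, Complex.exp (-Complex.I * (θ i : ℂ)) • (Uᵀ * A i * V).map Complex.ofReal

/-- 𝕋_a(θ) = −CV (Uᵀ A0 V + Σ Uᵀ A_i V e^{−jθ_i})⁻¹ Uᵀ B. -/
noncomputable def TaBar {n m ν n_w n_z : ℕ} (A0 : Matrix (Fin n) (Fin n) ℝ)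
    (A : Fin m → Matrix (Fin n) (Fin n) ℝ)
    (B : Matrix (Fin n) (Fin n_w) ℝ) (C : Matrix (Fin n_z) (Fin n) ℝ)
    (U V : Matrix (Fin n) (Fin ν) ℝ) (θ : Fin m → ℝ) :
    Matrix (Fin n_z) (Fin n_w) ℂ :=
  -((C * V).map Complex.ofReal * (ABar A0 A U V θ)⁻¹ * (Uᵀ * B).map Complex.ofReal)

/-- strong H∞-type value: lim_{ε→0+} (i.e. inf over ε > 0, by monotonicity) of
    sup { H r : r in the open Euclidean ball B(τ, ε) with all components positive }. -/
noncomputable def strongVal {m : ℕ} (H : (Fin m → ℝ) → ℝ) (τ : Fin m → ℝ) : ℝ :=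
  ⨅ ε : {e : ℝ // 0 < e},
    sSup {x : ℝ | ∃ r : Fin m → ℝ,
      (∑ i, (r i - τ i) ^ 2) < (ε : ℝ) ^ 2 ∧ (∀ i, 0 < r i) ∧ x = H r}

/-- ξ is a singular value of M: ξ ≥ 0 and ξ² is an eigenvalue of MᴴM. -/
def IsSingularValue {p q : ℕ} (M : Matrix (Fin p) (Fin q) ℂ) (ξ : ℝ) : Prop :=
  0 ≤ ξ ∧ ∃ v : Fin q → ℂ, v ≠ 0 ∧ (Mᴴ * M) *ᵥ v = ((ξ : ℂ) ^ 2) • v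

/-- strong stability hypotheses: on some ball of positive delay vectors around τ,
    the characteristic matrices are invertible in the closed right half plane and
    the inverse of the asymptotic characteristic matrix is uniformly bounded there. -/
def StrongHyp {n m ν : ℕ} (E A0 : Matrix (Fin n) (Fin n) ℝ)
    (A : Fin m → Matrix (Fin n) (Fin n) ℝ)
    (U V : Matrix (Fin n) (Fin ν) ℝ) (τ : Fin m → ℝ) : Prop :=
  ∃ ε0 : ℝ, 0 < ε0 ∧
    (∀ r : Fin m → ℝ, (∑ i, (r i - τ i) ^ 2) < ε0 ^ 2 → (∀ i, 0 < r i) →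
      ∀ lam : ℂ, 0 ≤ lam.re →
        IsUnit (Delta E A0 A r lam) ∧ IsUnit (DeltaA A0 A U V r lam)) ∧
    ∃ Mb : ℝ, ∀ r : Fin m → ℝ, (∑ i, (r i - τ i) ^ 2) < ε0 ^ 2 → (∀ i, 0 < r i) →
      ∀ lam : ℂ, 0 ≤ lam.re → sigma1 ((DeltaA A0 A U V r lam)⁻¹) ≤ Mb


section helpers
open scoped Matrix.Norms.L2Operator

theorem sigma1_eq_norm {p q : ℕ} (M : Matrix (Fin p) (Fin q) ℂ) : sigma1 M = ‖M‖ := rfl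

theorem zeros_bound (ρ : ℝ) (hρ : 0 < ρ) (w : ℂ) (hw : ‖w‖ ≤ ρ) (S : Finset ℂ) :
    ∀ (f : ℂ → ℂ) (M : ℝ), Differentiable ℂ f → (∀ z, ‖z‖ = 5 * ρ → ‖f z‖ ≤ M) →
    (∀ a ∈ S, ‖a‖ ≤ ρ ∧ f a = 0) → ‖f w‖ ≤ M / 2 ^ S.card := by
  induction S using Finset.induction_on with
  | empty =>
    intro f M hf hM _
    simp only [Finset.card_empty, pow_zero, div_one]
    refine Complex.norm_le_of_forall_mem_frontier_norm_le (U := Metric.ball 0 (5 * ρ))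
      Metric.isBounded_ball hf.diffContOnCl ?_ ?_
    · intro z hz
      rw [frontier_ball _ (by positivity)] at hz
      exact hM z (by simpa using hz)
    · apply subset_closure
      simp; linarith
  | insert a S ha ih =>
    intro f M hf hM hS
    have haρ := (hS a (Finset.mem_insert_self _ _)).1
    have hfa := (hS a (Finset.mem_insert_self _ _)).2
    have hmul : ∀ z, f z = (z - a) * dslope f a z := by
      intro z
      have := sub_smul_dslope f a z
      rw [hfa, smul_eq_mul, sub_zero] at this
      exact this.symm
    have hd : Differentiable ℂ (dslope f a) := by
      rw [← differentiableOn_univ, Complex.differentiableOn_dslope Filter.univ_mem]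
      exact hf.differentiableOn
    have := ih (dslope f a) (M / (4 * ρ)) hd ?_ ?_
    · rw [hmul w, norm_mul, Finset.card_insert_of_notMem ha]
      have h1 : ‖w - a‖ ≤ 2 * ρ := (norm_sub_le _ _).trans (by linarith)
      calc ‖w - a‖ * ‖dslope f a w‖ ≤ (2 * ρ) * (M / (4 * ρ) / 2 ^ S.card) := by gcongr
        _ = M / 2 ^ (S.card + 1) := by field_simp; ring
    · intro z hz
      have h1 := hM z hz
      rw [hmul z, norm_mul] at h1
      have h2 : 4 * ρ ≤ ‖z - a‖ := by
        have := norm_sub_norm_le z a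
        linarith
      rw [le_div_iff₀ (by positivity)]
      nlinarith [norm_nonneg (dslope f a z)]
    · intro b hb
      refine ⟨(hS b (Finset.mem_insert_of_mem hb)).1, ?_⟩
      have hba : b ≠ a := fun h => ha (h ▸ hb)
      have h3 := hmul b
      rw [(hS b (Finset.mem_insert_of_mem hb)).2] at h3
      rcases mul_eq_zero.1 h3.symm with h | h
      · exact absurd (sub_eq_zero.1 h) hba
      · exact h

theorem map_mul_c {a b c : ℕ} (X : Matrix (Fin a) (Fin b) ℝ) (Y : Matrix (Fin b) (Fin c) ℝ) :
    (X * Y).map Complex.ofReal = X.map Complex.ofReal * Y.map Complex.ofReal :=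
  Matrix.map_mul (f := Complex.ofRealHom)

theorem asymp_identity {n ν : ℕ} (E M G : Matrix (Fin n) (Fin n) ℂ)
    (L V : Matrix (Fin n) (Fin ν) ℂ) (Ut : Matrix (Fin ν) (Fin n) ℂ)
    (hEV : E * V = 0) (hUE : Ut * E = 0) (hG : E * G + L * Ut = 1) (lam : ℂ)
    (hD : IsUnit (lam • E - M)) (hW : IsUnit (Ut * M * V)) :
    lam • ((lam • E - M)⁻¹ + V * (Ut * M * V)⁻¹ * Ut) =
      (1 + (((lam • E - M)⁻¹ + V * (Ut * M * V)⁻¹ * Ut) - V * (Ut * M * V)⁻¹ * Ut) * M) * G *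
        (1 - M * (V * (Ut * M * V)⁻¹ * Ut)) := by
  set D := lam • E - M with hDdef
  set W := Ut * M * V with hWdef
  have hD' := (Matrix.isUnit_iff_isUnit_det _).1 hD
  have hW' := (Matrix.isUnit_iff_isUnit_det _).1 hW
  have hMV : D⁻¹ * (M * V) = - V := by
    have : M * V = - (D * V) := by
      rw [hDdef, Matrix.sub_mul, Matrix.smul_mul, hEV]; simp
    rw [this, Matrix.mul_neg, ← Matrix.mul_assoc, Matrix.nonsing_inv_mul _ hD', Matrix.one_mul]
  have h1 : D⁻¹ * (1 - M * (V * W⁻¹ * Ut)) = D⁻¹ + V * W⁻¹ * Ut := by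
    have : D⁻¹ * (M * (V * W⁻¹ * Ut)) = (D⁻¹ * (M * V)) * (W⁻¹ * Ut) := by
      simp only [Matrix.mul_assoc]
    rw [Matrix.mul_sub, this, hMV]
    simp [Matrix.mul_assoc]
  have h2 : Ut * (1 - M * (V * W⁻¹ * Ut)) = 0 := by
    have : Ut * (M * (V * W⁻¹ * Ut)) = (W * W⁻¹) * Ut := by
      simp only [hWdef, Matrix.mul_assoc]
    rw [Matrix.mul_sub, this, Matrix.mul_nonsing_inv _ hW']
    simp
  have h3 : (1 - M * (V * W⁻¹ * Ut)) = E * G * (1 - M * (V * W⁻¹ * Ut)) := by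
    have h5 := congrArg (fun Z => Z * (1 - M * (V * W⁻¹ * Ut))) hG
    simp only [Matrix.add_mul] at h5
    rw [Matrix.mul_assoc L, h2, Matrix.mul_zero, add_zero, Matrix.one_mul] at h5
    exact h5.symm
  have h4 : lam • (D⁻¹ * E) = 1 + D⁻¹ * M := by
    have : lam • E = D + M := by rw [hDdef]; abel
    rw [← Matrix.mul_smul, this, Matrix.mul_add, Matrix.nonsing_inv_mul _ hD']
  rw [add_sub_cancel_right, ← h4, ← h1]
  conv_lhs => rw [h3]
  simp only [Matrix.smul_mul, Matrix.mul_assoc]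

set_option maxHeartbeats 2000000 in
theorem asymp_bound {n ν : ℕ} (E G : Matrix (Fin n) (Fin n) ℂ)
    (L V : Matrix (Fin n) (Fin ν) ℂ) (Ut : Matrix (Fin ν) (Fin n) ℂ)
    (hEV : E * V = 0) (hUE : Ut * E = 0) (hG : E * G + L * Ut = 1) (K k1 : ℝ) (hK : 0 ≤ K)
    (hk1 : 0 ≤ k1) (δ : ℝ) (hδ : 0 < δ) :
    ∃ Om : ℝ, 0 < Om ∧ ∀ (lam : ℂ) (M : Matrix (Fin n) (Fin n) ℂ), Om ≤ ‖lam‖ → ‖M‖ ≤ K →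
      IsUnit (lam • E - M) → IsUnit (Ut * M * V) → ‖V * (Ut * M * V)⁻¹ * Ut‖ ≤ k1 →
      ‖(lam • E - M)⁻¹ + V * (Ut * M * V)⁻¹ * Ut‖ ≤ δ := by
  set o := ‖(1 : Matrix (Fin n) (Fin n) ℂ)‖ with ho
  have ho0 : 0 ≤ o := norm_nonneg _
  set a := ‖G‖ * (o + K * k1) with ha
  have ha0 : 0 ≤ a := by positivity
  refine ⟨K * a + ((o + k1 * K) * a) / δ + 1, by positivity, ?_⟩
  intro lam M hlam hM hD hW hk
  have key := asymp_identity E M G L V Ut hEV hUE hG lam hD hW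
  generalize (lam • E - M)⁻¹ + V * (Ut * M * V)⁻¹ * Ut = X at key ⊢
  generalize V * (Ut * M * V)⁻¹ * Ut = Y at key hk
  have h1 : ‖lam‖ * ‖X‖ ≤ (o + (‖X‖ + k1) * K) * ‖G‖ * (o + K * k1) := by
    rw [← norm_smul, key]
    refine (Matrix.l2_opNorm_mul _ _).trans ?_
    have e1 : ‖(1 : Matrix (Fin n) (Fin n) ℂ) - M * Y‖ ≤ o + K * k1 := by
      refine (norm_sub_le _ _).trans ?_
      have := Matrix.l2_opNorm_mul M Y
      have : ‖M‖ * ‖Y‖ ≤ K * k1 := mul_le_mul hM hk (norm_nonneg _) hK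
      linarith
    have e2 : ‖(1 : Matrix (Fin n) (Fin n) ℂ) + (X - Y) * M‖ ≤ o + (‖X‖ + k1) * K := by
      refine (norm_add_le _ _).trans ?_
      have h5 := Matrix.l2_opNorm_mul (X - Y) M
      have h6 : ‖X - Y‖ ≤ ‖X‖ + k1 := (norm_sub_le _ _).trans (by linarith)
      have : ‖X - Y‖ * ‖M‖ ≤ (‖X‖ + k1) * K := mul_le_mul h6 hM (norm_nonneg _) (by positivity)
      linarith
    have e3 := Matrix.l2_opNorm_mul (1 + (X - Y) * M) G
    refine mul_le_mul (e3.trans ?_) e1 (norm_nonneg _) (by positivity)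
    exact mul_le_mul_of_nonneg_right e2 (norm_nonneg _)
  have h2 : ‖lam‖ * ‖X‖ ≤ (o + k1 * K) * a + K * a * ‖X‖ := by
    refine h1.trans (le_of_eq ?_); rw [ha]; ring
  have h3 : (K * a + ((o + k1 * K) * a) / δ + 1) * ‖X‖ ≤ ‖lam‖ * ‖X‖ :=
    mul_le_mul_of_nonneg_right hlam (norm_nonneg _)
  by_contra! hc
  have h4 : ((o + k1 * K) * a) / δ * δ = (o + k1 * K) * a := by field_simp
  have h5 : 0 ≤ ((o + k1 * K) * a) / δ := by positivity
  nlinarith [mul_le_mul_of_nonneg_left hc.le h5]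

theorem exists_GL {n ν : ℕ} (E : Matrix (Fin n) (Fin n) ℝ) (U : Matrix (Fin n) (Fin ν) ℝ)
    (hν : ν = n - E.rank) (hU : U.rank = ν) (hUE : Uᵀ * E = 0) :
    ∃ (G : Matrix (Fin n) (Fin n) ℝ) (L : Matrix (Fin n) (Fin ν) ℝ), E * G + L * Uᵀ = 1 := by
  have hErank : E.rank ≤ n := by simpa using E.rank_le_width
  have hrT : Uᵀ.rank = ν := by rw [Matrix.rank_transpose, hU]
  have hrange : LinearMap.range Uᵀ.mulVecLin = ⊤ := by
    apply Submodule.eq_top_of_finrank_eq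
    have : Module.finrank ℝ (LinearMap.range Uᵀ.mulVecLin) = ν := hrT
    rw [this]; simp
  have hker : LinearMap.range E.mulVecLin = LinearMap.ker Uᵀ.mulVecLin := by
    apply Submodule.eq_of_le_of_finrank_eq
    · rintro _ ⟨x, rfl⟩
      rw [LinearMap.mem_ker, Matrix.mulVecLin_apply, Matrix.mulVecLin_apply,
        Matrix.mulVec_mulVec, hUE, Matrix.zero_mulVec]
    · have h1 := LinearMap.finrank_range_add_finrank_ker Uᵀ.mulVecLin
      have h2 : Module.finrank ℝ (LinearMap.range Uᵀ.mulVecLin) = ν := hrT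
      have h3 : Module.finrank ℝ (LinearMap.range E.mulVecLin) = E.rank := rfl
      simp at h1
      omega
  have hL : ∃ L : Matrix (Fin n) (Fin ν) ℝ, Uᵀ * L = 1 := by
    have : ∀ j : Fin ν, ∃ x : Fin n → ℝ, Uᵀ *ᵥ x = Pi.single j 1 := fun j => by
      have : (Pi.single j 1 : Fin ν → ℝ) ∈ LinearMap.range Uᵀ.mulVecLin := by rw [hrange]; trivial
      exact this
    choose x hx using this
    refine ⟨Matrix.of fun i j => x j i, ?_⟩
    ext i j
    have := congrFun (hx j) i
    rw [Matrix.mul_apply]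
    simp only [Matrix.mulVec, dotProduct] at this
    simpa [Matrix.one_apply, Pi.single_apply] using this
  obtain ⟨L, hL⟩ := hL
  have hG : ∃ G : Matrix (Fin n) (Fin n) ℝ, E * G = 1 - L * Uᵀ := by
    have : ∀ j : Fin n, ∃ x : Fin n → ℝ, E *ᵥ x = (1 - L * Uᵀ).col j := fun j => by
      have : (1 - L * Uᵀ).col j ∈ LinearMap.range E.mulVecLin := by
        rw [hker, LinearMap.mem_ker]
        have h0 : Uᵀ * (1 - L * Uᵀ) = 0 := by
          rw [Matrix.mul_sub, ← Matrix.mul_assoc, hL]; simp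
        ext i
        have := congrFun (congrFun h0 i) j
        rw [Matrix.mul_apply] at this
        exact this
      exact this
    choose x hx using this
    refine ⟨Matrix.of fun i j => x j i, ?_⟩
    ext i j
    have := congrFun (hx j) i
    exact this
  obtain ⟨G, hG⟩ := hG
  exact ⟨G, L, by rw [hG]; simp⟩

/-- A0 + Σ A_i e^{-λ r_i} -/
noncomputable def Mm {n m : ℕ} (A0 : Matrix (Fin n) (Fin n) ℝ)
    (A : Fin m → Matrix (Fin n) (Fin n) ℝ) (r : Fin m → ℝ) (lam : ℂ) :
    Matrix (Fin n) (Fin n) ℂ :=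
  A0.map Complex.ofReal + ∑ i, Complex.exp (-lam * (r i : ℂ)) • (A i).map Complex.ofReal

theorem Delta_eq {n m : ℕ} (E A0 : Matrix (Fin n) (Fin n) ℝ)
    (A : Fin m → Matrix (Fin n) (Fin n) ℝ) (r : Fin m → ℝ) (lam : ℂ) :
    Delta E A0 A r lam = lam • E.map Complex.ofReal - Mm A0 A r lam := by
  rw [Delta, Mm]; abel

theorem DeltaA_eq {n m ν : ℕ} (A0 : Matrix (Fin n) (Fin n) ℝ)
    (A : Fin m → Matrix (Fin n) (Fin n) ℝ) (U V : Matrix (Fin n) (Fin ν) ℝ)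
    (r : Fin m → ℝ) (lam : ℂ) :
    DeltaA A0 A U V r lam =
      Uᵀ.map Complex.ofReal * Mm A0 A r lam * V.map Complex.ofReal := by
  rw [DeltaA, Mm]
  simp only [map_mul_c, Matrix.mul_add, Matrix.add_mul, Matrix.mul_sum, Matrix.sum_mul,
    Matrix.mul_smul, Matrix.smul_mul]

theorem Mm_norm_le {n m : ℕ} (A0 : Matrix (Fin n) (Fin n) ℝ)
    (A : Fin m → Matrix (Fin n) (Fin n) ℝ) (r : Fin m → ℝ) (w : ℝ) :
    ‖Mm A0 A r (Complex.I * (w : ℂ))‖ ≤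
      ‖A0.map Complex.ofReal‖ + ∑ i, ‖(A i).map Complex.ofReal‖ := by
  rw [Mm]
  refine (norm_add_le _ _).trans ?_
  gcongr
  refine (norm_sum_le _ _).trans ?_
  gcongr with i
  rw [norm_smul, Complex.norm_exp]
  simp

theorem sv_le_norm {p q : ℕ} (M : Matrix (Fin p) (Fin q) ℂ) (x : ℝ) (h : IsSingularValue M x) :
    x ≤ ‖M‖ := by
  obtain ⟨hx, v, hv, he⟩ := h
  have h1 := Matrix.l2_opNorm_mulVec (Mᴴ * M) (WithLp.toLp 2 v)
  rw [Matrix.l2_opNorm_conjTranspose_mul_self] at h1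
  have h2 : (WithLp.toLp 2 ((Mᴴ * M) *ᵥ v) : EuclideanSpace ℂ (Fin q)) =
      ((x : ℂ) ^ 2) • WithLp.toLp 2 v := by
    rw [he]; rfl
  have h3 : 0 < ‖(WithLp.toLp 2 v : EuclideanSpace ℂ (Fin q))‖ := by
    rw [norm_pos_iff]
    intro h0
    apply hv
    simpa using h0
  have h4 : ‖((x : ℂ) ^ 2) • (WithLp.toLp 2 v : EuclideanSpace ℂ (Fin q))‖ ≤
      ‖M‖ * ‖M‖ * ‖(WithLp.toLp 2 v : EuclideanSpace ℂ (Fin q))‖ := by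
    rw [← h2]; exact h1
  rw [norm_smul] at h4
  have h5 := le_of_mul_le_mul_right h4 h3
  rw [norm_pow, Complex.norm_real, Real.norm_eq_abs, sq_abs] at h5
  exact abs_le_of_sq_le_sq' (by nlinarith) (norm_nonneg _) |>.2

/-- numerator -/
noncomputable def NumT {n m n_w n_z : ℕ} (E A0 : Matrix (Fin n) (Fin n) ℝ)
    (A : Fin m → Matrix (Fin n) (Fin n) ℝ)
    (B : Matrix (Fin n) (Fin n_w) ℝ) (C : Matrix (Fin n_z) (Fin n) ℝ)
    (r : Fin m → ℝ) (lam : ℂ) : Matrix (Fin n_z) (Fin n_w) ℂ :=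
  C.map Complex.ofReal * (Delta E A0 A r lam).adjugate * B.map Complex.ofReal

/-- entire function whose real zeros contain the frequencies -/
noncomputable def gfun {n m n_w n_z : ℕ} (E A0 : Matrix (Fin n) (Fin n) ℝ)
    (A : Fin m → Matrix (Fin n) (Fin n) ℝ)
    (B : Matrix (Fin n) (Fin n_w) ℝ) (C : Matrix (Fin n_z) (Fin n) ℝ) (x : ℝ)
    (r : Fin m → ℝ) (z : ℂ) : ℂ :=
  ((NumT E A0 A B C r (-(Complex.I * z)))ᵀ * NumT E A0 A B C r (Complex.I * z) -
    ((Delta E A0 A r (-(Complex.I * z))).det * (Delta E A0 A r (Complex.I * z)).det *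
      (x : ℂ) ^ 2) • (1 : Matrix (Fin n_w) (Fin n_w) ℂ)).det

theorem NumT_eq {n m n_w n_z : ℕ} (E A0 : Matrix (Fin n) (Fin n) ℝ)
    (A : Fin m → Matrix (Fin n) (Fin n) ℝ)
    (B : Matrix (Fin n) (Fin n_w) ℝ) (C : Matrix (Fin n_z) (Fin n) ℝ)
    (r : Fin m → ℝ) (lam : ℂ) (h : IsUnit (Delta E A0 A r lam)) :
    NumT E A0 A B C r lam = (Delta E A0 A r lam).det • Ttf E A0 A B C r lam := by
  have h' := (Matrix.isUnit_iff_isUnit_det _).1 h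
  rw [NumT, Ttf, Matrix.inv_def, Ring.inverse_eq_inv']
  simp only [Matrix.mul_smul, Matrix.smul_mul, smul_smul]
  rw [mul_inv_cancel₀ h'.ne_zero, one_smul]

theorem Delta_conj {n m : ℕ} (E A0 : Matrix (Fin n) (Fin n) ℝ)
    (A : Fin m → Matrix (Fin n) (Fin n) ℝ) (r : Fin m → ℝ) (w : ℝ) :
    (Delta E A0 A r (-(Complex.I * w)))ᵀ = (Delta E A0 A r (Complex.I * w))ᴴ := by
  ext i j
  simp [Delta, Matrix.sum_apply, ← Complex.exp_conj]

theorem Ttf_conj {n m n_w n_z : ℕ} (E A0 : Matrix (Fin n) (Fin n) ℝ)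
    (A : Fin m → Matrix (Fin n) (Fin n) ℝ)
    (B : Matrix (Fin n) (Fin n_w) ℝ) (C : Matrix (Fin n_z) (Fin n) ℝ)
    (r : Fin m → ℝ) (w : ℝ) :
    (Ttf E A0 A B C r (-(Complex.I * w)))ᵀ = (Ttf E A0 A B C r (Complex.I * w))ᴴ := by
  have hr : ∀ {a b : ℕ} (X : Matrix (Fin a) (Fin b) ℝ),
      (X.map Complex.ofReal)ᵀ = (X.map Complex.ofReal)ᴴ := by
    intro a b X; ext i j; simp
  simp only [Ttf, Matrix.transpose_mul, Matrix.conjTranspose_mul, hr,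
    Matrix.transpose_nonsing_inv, Matrix.conjTranspose_nonsing_inv, Delta_conj]

theorem gfun_zero_iff {n m n_w n_z : ℕ} (E A0 : Matrix (Fin n) (Fin n) ℝ)
    (A : Fin m → Matrix (Fin n) (Fin n) ℝ)
    (B : Matrix (Fin n) (Fin n_w) ℝ) (C : Matrix (Fin n_z) (Fin n) ℝ) (x : ℝ) (hx : 0 ≤ x)
    (r : Fin m → ℝ) (w : ℝ) (h1 : IsUnit (Delta E A0 A r (Complex.I * w)))
    (h2 : IsUnit (Delta E A0 A r (-(Complex.I * w)))) :
    gfun E A0 A B C x r w = 0 ↔ IsSingularValue (Ttf E A0 A B C r (Complex.I * w)) x := by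
  have h1' := ((Matrix.isUnit_iff_isUnit_det _).1 h1).ne_zero
  have h2' := ((Matrix.isUnit_iff_isUnit_det _).1 h2).ne_zero
  rw [gfun, NumT_eq _ _ _ _ _ _ _ h1, NumT_eq _ _ _ _ _ _ _ h2, Matrix.transpose_smul, Ttf_conj,
    Matrix.smul_mul, Matrix.mul_smul, smul_smul, ← smul_smul (_ * _), ← smul_sub, Matrix.det_smul,
    mul_eq_zero, or_iff_right (pow_ne_zero _ (mul_ne_zero h2' h1')),
    ← Matrix.exists_mulVec_eq_zero_iff, IsSingularValue, and_iff_right hx]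
  simp only [Matrix.sub_mulVec, Matrix.smul_mulVec, Matrix.one_mulVec, sub_eq_zero]

theorem continuous_Delta {n m : ℕ} (E A0 : Matrix (Fin n) (Fin n) ℝ)
    (A : Fin m → Matrix (Fin n) (Fin n) ℝ) :
    Continuous fun p : (Fin m → ℝ) × ℂ => Delta E A0 A p.1 p.2 := by
  unfold Delta
  fun_prop

theorem continuous_gfun {n m n_w n_z : ℕ} (E A0 : Matrix (Fin n) (Fin n) ℝ)
    (A : Fin m → Matrix (Fin n) (Fin n) ℝ)
    (B : Matrix (Fin n) (Fin n_w) ℝ) (C : Matrix (Fin n_z) (Fin n) ℝ) (x : ℝ) :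
    Continuous fun p : (Fin m → ℝ) × ℂ => gfun E A0 A B C x p.1 p.2 := by
  have hp : Continuous fun p : (Fin m → ℝ) × ℂ => Delta E A0 A p.1 (Complex.I * p.2) :=
    (continuous_Delta E A0 A).comp (f := fun p : (Fin m → ℝ) × ℂ => (p.1, Complex.I * p.2))
      (by fun_prop)
  have hn : Continuous fun p : (Fin m → ℝ) × ℂ => Delta E A0 A p.1 (-(Complex.I * p.2)) :=
    (continuous_Delta E A0 A).comp (f := fun p : (Fin m → ℝ) × ℂ => (p.1, -(Complex.I * p.2)))
      (by fun_prop)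
  unfold gfun NumT
  refine Continuous.matrix_det (Continuous.sub ?_ ?_)
  · exact (((continuous_const.matrix_mul hn.matrix_adjugate).matrix_mul
      continuous_const).matrix_transpose).matrix_mul
      ((continuous_const.matrix_mul hp.matrix_adjugate).matrix_mul continuous_const)
  · exact ((hn.matrix_det.mul hp.matrix_det).mul continuous_const).smul continuous_const

theorem diff_det {k : ℕ} (F : ℂ → Matrix (Fin k) (Fin k) ℂ)
    (h : ∀ i j, Differentiable ℂ fun z => F z i j) : Differentiable ℂ fun z => (F z).det := by
  simp only [Matrix.det_apply]
  refine Differentiable.fun_sum fun s _ => ?_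
  refine Differentiable.const_smul (Differentiable.fun_finsetProd fun i _ => h _ _) _

theorem diff_gfun {n m n_w n_z : ℕ} (E A0 : Matrix (Fin n) (Fin n) ℝ)
    (A : Fin m → Matrix (Fin n) (Fin n) ℝ)
    (B : Matrix (Fin n) (Fin n_w) ℝ) (C : Matrix (Fin n_z) (Fin n) ℝ) (x : ℝ)
    (r : Fin m → ℝ) : Differentiable ℂ fun z => gfun E A0 A B C x r z := by
  have hD : ∀ (s : ℂ → ℂ), Differentiable ℂ s → ∀ i j,
      Differentiable ℂ fun z => Delta E A0 A r (s z) i j := by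
    intro s hs i j
    simp only [Delta, Matrix.sub_apply, Matrix.smul_apply, Matrix.sum_apply, smul_eq_mul]
    fun_prop
  have hAdj : ∀ (s : ℂ → ℂ), Differentiable ℂ s → ∀ i j,
      Differentiable ℂ fun z => (Delta E A0 A r (s z)).adjugate i j := by
    intro s hs i j
    simp only [Matrix.adjugate_apply]
    apply diff_det
    intro k l
    simp only [Matrix.updateRow_apply]
    split_ifs
    · exact differentiable_const _
    · exact hD s hs _ _
  have hN : ∀ (s : ℂ → ℂ), Differentiable ℂ s → ∀ i j,
      Differentiable ℂ fun z => NumT E A0 A B C r (s z) i j := by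
    intro s hs i j
    simp only [NumT, Matrix.mul_apply]
    refine Differentiable.fun_sum fun k _ => Differentiable.mul_const
      (Differentiable.fun_sum fun l _ => Differentiable.const_mul (hAdj s hs _ _) _) _
  have hs1 : Differentiable ℂ fun z : ℂ => Complex.I * z := by fun_prop
  have hs2 : Differentiable ℂ fun z : ℂ => -(Complex.I * z) := by fun_prop
  unfold gfun
  apply diff_det
  intro i j
  simp only [Matrix.sub_apply, Matrix.smul_apply, Matrix.mul_apply, Matrix.transpose_apply,
    smul_eq_mul]
  refine Differentiable.sub (Differentiable.fun_sum fun k _ => (hN _ hs2 _ _).mul (hN _ hs1 _ _)) ?_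
  exact Differentiable.mul_const (((diff_det _ (hD _ hs2)).mul (diff_det _ (hD _ hs1))).mul_const _) _

theorem TaBar_bdd {n m ν n_w n_z : ℕ} (A0 : Matrix (Fin n) (Fin n) ℝ)
    (A : Fin m → Matrix (Fin n) (Fin n) ℝ)
    (B : Matrix (Fin n) (Fin n_w) ℝ) (C : Matrix (Fin n_z) (Fin n) ℝ)
    (U V : Matrix (Fin n) (Fin ν) ℝ)
    (hθ : ∀ θ : Fin m → ℝ, (∀ i, θ i ∈ Set.Icc (0 : ℝ) (2 * Real.pi)) →
      IsUnit (ABar A0 A U V θ)) :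
    ∃ K : ℝ, ∀ (r : Fin m → ℝ) (w : ℝ), sigma1 (Ta A0 A B C U V r (Complex.I * (w : ℂ))) ≤ K := by
  have hc : Continuous fun θ : Fin m → ℝ => ABar A0 A U V θ := by
    unfold ABar; fun_prop
  have hcomp : IsCompact (Set.univ.pi fun _ : Fin m => Set.Icc (0 : ℝ) (2 * Real.pi)) :=
    isCompact_univ_pi fun _ => isCompact_Icc
  have hinv : ContinuousOn (fun θ : Fin m → ℝ => (ABar A0 A U V θ)⁻¹)
      (Set.univ.pi fun _ : Fin m => Set.Icc (0 : ℝ) (2 * Real.pi)) := by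
    simp only [Matrix.inv_def, Ring.inverse_eq_inv']
    refine ContinuousOn.smul (ContinuousOn.inv₀ hc.matrix_det.continuousOn ?_)
      hc.matrix_adjugate.continuousOn
    intro θ h
    exact ((Matrix.isUnit_iff_isUnit_det _).1 (hθ θ fun i => h i trivial)).ne_zero
  obtain ⟨K, hK⟩ := hcomp.exists_bound_of_continuousOn hinv
  refine ⟨‖(C * V).map Complex.ofReal‖ * K * ‖(Uᵀ * B).map Complex.ofReal‖, ?_⟩
  intro r w
  have hEq : DeltaA A0 A U V r (Complex.I * w) =
      ABar A0 A U V (fun i => toIcoMod Real.two_pi_pos 0 (w * r i)) := by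
    unfold DeltaA ABar
    congr 1
    refine Finset.sum_congr rfl fun i _ => ?_
    congr 1
    rw [Complex.exp_eq_exp_iff_exists_int]
    refine ⟨-toIcoDiv Real.two_pi_pos 0 (w * r i), ?_⟩
    have := toIcoMod_add_toIcoDiv_zsmul Real.two_pi_pos 0 (w * r i)
    have h2 : (w : ℂ) * (r i : ℂ) = ((toIcoMod Real.two_pi_pos 0 (w * r i) : ℝ) : ℂ) +
        (toIcoDiv Real.two_pi_pos 0 (w * r i) : ℂ) * (2 * Real.pi) := by
      rw [zsmul_eq_mul] at this
      exact_mod_cast this.symm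
    push_cast
    linear_combination (-Complex.I) * h2
  rw [sigma1_eq_norm, Ta, norm_neg, hEq]
  refine (Matrix.l2_opNorm_mul _ _).trans ?_
  refine mul_le_mul_of_nonneg_right ?_ (norm_nonneg _)
  refine (Matrix.l2_opNorm_mul _ _).trans ?_
  refine mul_le_mul_of_nonneg_left ?_ (norm_nonneg _)
  apply hK
  intro i _
  have := toIcoMod_mem_Ico Real.two_pi_pos 0 (w * r i)
  rw [zero_add] at this
  exact ⟨this.1, this.2.le⟩

theorem strong_extract {m : ℕ} (F : (Fin m → ℝ) → ℝ → ℝ) (K : ℝ) (hF : ∀ r w, F r w ≤ K)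
    (hF0 : ∀ r w, 0 ≤ F r w) (τ : Fin m → ℝ) (x : ℝ)
    (h : strongVal (fun r => ⨆ w : ℝ, F r w) τ < x) :
    ∃ e : ℝ, 0 < e ∧ ∃ S : ℝ, 0 ≤ S ∧ S < x ∧ ∀ r : Fin m → ℝ, (∑ i, (r i - τ i) ^ 2) < e ^ 2 →
      (∀ i, 0 < r i) → ∀ w, F r w ≤ S := by
  have : Nonempty {e : ℝ // 0 < e} := ⟨⟨1, one_pos⟩⟩
  obtain ⟨⟨e, he⟩, hlt⟩ := exists_lt_of_ciInf_lt h
  refine ⟨e, he, _, ?_, hlt, ?_⟩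
  · apply Real.sSup_nonneg
    rintro y ⟨r, -, -, rfl⟩
    exact Real.iSup_nonneg (hF0 r)
  · intro r hr hpos w
    have hb : BddAbove (Set.range (F r)) := ⟨K, by rintro _ ⟨w, rfl⟩; exact hF r w⟩
    refine (le_ciSup hb w).trans ?_
    refine le_csSup ⟨K, ?_⟩ ⟨r, hr, hpos, rfl⟩
    rintro y ⟨r, -, -, rfl⟩
    exact ciSup_le (hF r)

theorem stmt9_aux (n m n_w n_z ν : ℕ)
    (E A0 : Matrix (Fin n) (Fin n) ℝ) (A : Fin m → Matrix (Fin n) (Fin n) ℝ)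
    (B : Matrix (Fin n) (Fin n_w) ℝ) (C : Matrix (Fin n_z) (Fin n) ℝ)
    (U V : Matrix (Fin n) (Fin ν) ℝ)
    (hν : ν = n - E.rank) (hU : U.rank = ν) (hV : V.rank = ν)
    (hUE : Uᵀ * E = 0) (hEV : E * V = 0)
    (τ : Fin m → ℝ) (hτ : ∀ i, 0 < τ i)
    (hstrong : StrongHyp E A0 A U V τ)
    (hθ : ∀ θ : Fin m → ℝ, (∀ i, θ i ∈ Set.Icc (0 : ℝ) (2 * Real.pi)) →
      IsUnit (ABar A0 A U V θ))
    (ξ : ℝ)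
    (hξ : strongVal (fun r => ⨆ ω : ℝ, sigma1 (Ta A0 A B C U V r (Complex.I * (ω : ℂ)))) τ < ξ) :
    ∃ ε : ℝ, 0 < ε ∧ ∃ Ω : ℝ, 0 < Ω ∧ ∃ N : ℕ,
      ∀ r : Fin m → ℝ, (∑ i, (r i - τ i) ^ 2) < ε ^ 2 → (∀ i, 0 < r i) →
        {ω : ℝ | IsSingularValue (Ttf E A0 A B C r (Complex.I * (ω : ℂ))) ξ}.Finite ∧
        {ω : ℝ | IsSingularValue (Ttf E A0 A B C r (Complex.I * (ω : ℂ))) ξ}.ncard < N ∧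
        ∀ ω : ℝ, IsSingularValue (Ttf E A0 A B C r (Complex.I * (ω : ℂ))) ξ → |ω| < Ω := by
  classical
  obtain ⟨K, hK⟩ := TaBar_bdd A0 A B C U V hθ
  obtain ⟨e1, he1, S, hS0, hSx, hS⟩ := strong_extract
    (fun r w => sigma1 (Ta A0 A B C U V r (Complex.I * (w : ℂ)))) K hK
    (fun r w => norm_nonneg _) τ ξ hξ
  have hξ0 : 0 < ξ := hS0.trans_lt hSx
  obtain ⟨e0, he0, hunit, Mb, hMb⟩ := hstrong
  obtain ⟨G, L, hGL⟩ := exists_GL E U hν hU hUE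
  have cEV : E.map Complex.ofReal * V.map Complex.ofReal = 0 := by
    rw [← map_mul_c, hEV]; ext i j; simp
  have cUE : Uᵀ.map Complex.ofReal * E.map Complex.ofReal = 0 := by
    rw [← map_mul_c, hUE]; ext i j; simp
  have cGL : E.map Complex.ofReal * G.map Complex.ofReal
      + L.map Complex.ofReal * Uᵀ.map Complex.ofReal = 1 := by
    rw [← map_mul_c, ← map_mul_c]
    ext i j
    have := congrArg Complex.ofReal (congrFun (congrFun hGL i) j)
    simp only [Matrix.add_apply, Complex.ofReal_add] at this
    simp only [Matrix.add_apply, Matrix.map_apply, this, Matrix.one_apply]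
    split_ifs <;> simp
  obtain ⟨Om, hOm0, hOm⟩ : ∃ Om : ℝ, 0 < Om ∧ ∀ r : Fin m → ℝ,
      (∑ i, (r i - τ i) ^ 2) < e0 ^ 2 → (∑ i, (r i - τ i) ^ 2) < e1 ^ 2 → (∀ i, 0 < r i) →
      ∀ w : ℝ, IsSingularValue (Ttf E A0 A B C r (Complex.I * (w : ℂ))) ξ → |w| < Om := by
    have hCB : 0 < ‖C.map Complex.ofReal‖ * ‖B.map Complex.ofReal‖ + 1 := by positivity
    obtain ⟨Om, hOm0, hOm⟩ := asymp_bound (E.map Complex.ofReal) (G.map Complex.ofReal)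
      (L.map Complex.ofReal) (V.map Complex.ofReal) (Uᵀ.map Complex.ofReal) cEV cUE cGL
      (‖A0.map Complex.ofReal‖ + ∑ i, ‖(A i).map Complex.ofReal‖)
      (‖V.map Complex.ofReal‖ * |Mb| * ‖Uᵀ.map Complex.ofReal‖) (by positivity) (by positivity)
      ((ξ - S) / 2 / (‖C.map Complex.ofReal‖ * ‖B.map Complex.ofReal‖ + 1))
      (div_pos (by linarith) hCB)
    refine ⟨Om, hOm0, ?_⟩
    intro r hr0 hr1 hpos w hsv
    by_contra! hw
    have hre : 0 ≤ (Complex.I * (w : ℂ)).re := by simp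
    obtain ⟨hu1, hu2⟩ := hunit r hr0 hpos _ hre
    have hb := hMb r hr0 hpos _ hre
    have hsv' := sv_le_norm _ _ hsv
    have hTa := hS r hr1 hpos w
    rw [sigma1_eq_norm] at hb hTa
    have hX := hOm (Complex.I * (w : ℂ)) (Mm A0 A r (Complex.I * (w : ℂ)))
      (by simpa using hw) (Mm_norm_le _ _ _ _) (by rw [← Delta_eq]; exact hu1)
      (by rw [← DeltaA_eq]; exact hu2) (by
        rw [← DeltaA_eq]
        refine (Matrix.l2_opNorm_mul _ _).trans ?_
        refine mul_le_mul_of_nonneg_right ?_ (norm_nonneg _)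
        refine (Matrix.l2_opNorm_mul _ _).trans ?_
        exact mul_le_mul_of_nonneg_left (hb.trans (le_abs_self _)) (norm_nonneg _))
    rw [← DeltaA_eq, ← Delta_eq] at hX
    have hdecomp : Ttf E A0 A B C r (Complex.I * (w : ℂ)) =
        Ta A0 A B C U V r (Complex.I * (w : ℂ)) + C.map Complex.ofReal *
          ((Delta E A0 A r (Complex.I * (w : ℂ)))⁻¹ + V.map Complex.ofReal *
            (DeltaA A0 A U V r (Complex.I * (w : ℂ)))⁻¹ * Uᵀ.map Complex.ofReal) *
          B.map Complex.ofReal := by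
      rw [Ttf, Ta, map_mul_c, map_mul_c]
      simp only [Matrix.mul_add, Matrix.add_mul, Matrix.mul_assoc]
      abel
    rw [hdecomp] at hsv'
    have h1 := hsv'.trans (norm_add_le _ _)
    have h2 := (Matrix.l2_opNorm_mul (C.map Complex.ofReal *
          ((Delta E A0 A r (Complex.I * (w : ℂ)))⁻¹ + V.map Complex.ofReal *
            (DeltaA A0 A U V r (Complex.I * (w : ℂ)))⁻¹ * Uᵀ.map Complex.ofReal))
          (B.map Complex.ofReal)).trans (mul_le_mul_of_nonneg_right
            (Matrix.l2_opNorm_mul _ _) (norm_nonneg _))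
    rw [le_div_iff₀ hCB] at hX
    nlinarith [norm_nonneg ((Delta E A0 A r (Complex.I * (w : ℂ)))⁻¹ + V.map Complex.ofReal *
            (DeltaA A0 A U V r (Complex.I * (w : ℂ)))⁻¹ * Uᵀ.map Complex.ofReal)]
  have hunits : ∀ r : Fin m → ℝ, (∑ i, (r i - τ i) ^ 2) < e0 ^ 2 → (∀ i, 0 < r i) → ∀ w : ℝ,
      IsUnit (Delta E A0 A r (Complex.I * (w : ℂ))) ∧
      IsUnit (Delta E A0 A r (-(Complex.I * (w : ℂ)))) := fun r hr hpos w =>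
    ⟨(hunit r hr hpos _ (by simp)).1, (hunit r hr hpos _ (by simp)).1⟩
  have hgc := continuous_gfun E A0 A B C ξ
  have hgτ : gfun E A0 A B C ξ τ (Om : ℂ) ≠ 0 := by
    intro h0
    have hz : ∀ e : ℝ, 0 < e → (∑ i, (τ i - τ i) ^ 2) < e ^ 2 := fun e he => by simp; positivity
    have hu := hunits τ (hz e0 he0) hτ Om
    have := hOm τ (hz e0 he0) (hz e1 he1) hτ Om
      ((gfun_zero_iff E A0 A B C ξ hξ0.le τ Om hu.1 hu.2).1 h0)
    rw [abs_of_pos hOm0] at this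
    exact lt_irrefl _ this
  obtain ⟨M, hM⟩ := ((isCompact_closedBall τ 1).prod
    (isCompact_closedBall (0 : ℂ) (5 * Om))).exists_bound_of_continuousOn hgc.continuousOn
  set c := ‖gfun E A0 A B C ξ τ (Om : ℂ)‖ / 2 with hc
  have hc0 : 0 < c := by have := norm_pos_iff.2 hgτ; positivity
  have hcont : Continuous fun r : Fin m → ℝ => ‖gfun E A0 A B C ξ r (Om : ℂ)‖ :=
    (hgc.comp (f := fun r : Fin m → ℝ => (r, (Om : ℂ))) (by fun_prop)).norm
  have hev : ∀ᶠ r in nhds τ, c < ‖gfun E A0 A B C ξ r (Om : ℂ)‖ :=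
    hcont.continuousAt.eventually (lt_mem_nhds (by
      change c < ‖gfun E A0 A B C ξ τ (Om : ℂ)‖
      linarith))
  obtain ⟨e2, he2, hball⟩ := Metric.eventually_nhds_iff_ball.1 hev
  obtain ⟨N, hN⟩ := pow_unbounded_of_one_lt (M / c) (one_lt_two : (1 : ℝ) < 2)
  set e := min (min e0 e1) (min e2 1) with hedef
  have he : 0 < e := by simp [hedef, he0, he1, he2]
  refine ⟨e, he, Om, hOm0, N, ?_⟩
  intro r hr hpos
  have hle : ∀ e' : ℝ, e ≤ e' → (∑ i, (r i - τ i) ^ 2) < e' ^ 2 := fun e' h =>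
    hr.trans_le (pow_le_pow_left₀ he.le h 2)
  have hr0 := hle e0 ((min_le_left _ _).trans (min_le_left _ _))
  have hr1 := hle e1 ((min_le_left _ _).trans (min_le_right _ _))
  have hee2 : e ≤ e2 := (min_le_right _ _).trans (min_le_left _ _)
  have hee3 : e ≤ 1 := (min_le_right _ _).trans (min_le_right _ _)
  have hdist : dist r τ < e := by
    rw [dist_pi_lt_iff he]
    intro i
    rw [Real.dist_eq]
    apply abs_lt_of_sq_lt_sq _ he.le
    exact (Finset.single_le_sum (f := fun i => (r i - τ i) ^ 2)
      (fun i _ => sq_nonneg _) (Finset.mem_univ i)).trans_lt hr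
  have hbound := hOm r hr0 hr1 hpos
  set Z := {ω : ℝ | IsSingularValue (Ttf E A0 A B C r (Complex.I * (ω : ℂ))) ξ} with hZ
  have hcard : ∀ s : Finset ℝ, (↑s : Set ℝ) ⊆ Z → s.card < N := by
    intro s hs
    have hb := zeros_bound Om hOm0 (Om : ℂ) (by simp [abs_of_pos hOm0])
      (s.map ⟨fun x : ℝ => (x : ℂ), Complex.ofReal_injective⟩) (gfun E A0 A B C ξ r) M
      (diff_gfun E A0 A B C ξ r)
      (fun z hz => hM (r, z) ⟨by simpa using (hdist.le.trans hee3), by simp [hz]⟩)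
      (by
        intro a ha
        obtain ⟨w, hw, rfl⟩ := Finset.mem_map.1 ha
        have hwZ : IsSingularValue (Ttf E A0 A B C r (Complex.I * (w : ℂ))) ξ := hs hw
        have hu := hunits r hr0 hpos w
        refine ⟨?_, (gfun_zero_iff E A0 A B C ξ hξ0.le r w hu.1 hu.2).2 hwZ⟩
        simpa using (hbound w hwZ).le)
    rw [Finset.card_map] at hb
    have hlow := hball r (Metric.mem_ball.2 (hdist.trans_le hee2))
    have h1 : c < M / 2 ^ s.card := hlow.trans_le hb
    rw [lt_div_iff₀ (by positivity)] at h1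
    rw [div_lt_iff₀ hc0] at hN
    have h2 : (2 : ℝ) ^ s.card < 2 ^ N := by nlinarith
    exact (pow_lt_pow_iff_right₀ one_lt_two).1 h2
  have hfin : Z.Finite := by
    by_contra hinf
    obtain ⟨t, ht, htc⟩ := Set.Infinite.exists_subset_card_eq hinf N
    exact absurd (hcard t ht) (by omega)
  refine ⟨hfin, ?_, hbound⟩
  rw [Set.ncard_eq_toFinset_card Z hfin]
  exact hcard _ (by simp)

end helpers

theorem stmt9 (n m n_w n_z ν : ℕ)
    (E A0 : Matrix (Fin n) (Fin n) ℝ) (A : Fin m → Matrix (Fin n) (Fin n) ℝ)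
    (B : Matrix (Fin n) (Fin n_w) ℝ) (C : Matrix (Fin n_z) (Fin n) ℝ)
    (U V : Matrix (Fin n) (Fin ν) ℝ)
    (hν : ν = n - E.rank) (hU : U.rank = ν) (hV : V.rank = ν)
    (hUE : Uᵀ * E = 0) (hEV : E * V = 0)
    (τ : Fin m → ℝ) (hτ : ∀ i, 0 < τ i)
    (hstrong : StrongHyp E A0 A U V τ)
    (hθ : ∀ θ : Fin m → ℝ, (∀ i, θ i ∈ Set.Icc (0 : ℝ) (2 * Real.pi)) →
      IsUnit (ABar A0 A U V θ))
    (ξ : ℝ)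
    (hξ : strongVal (fun r => ⨆ ω : ℝ, sigma1 (Ta A0 A B C U V r (Complex.I * (ω : ℂ)))) τ < ξ) :
    ∃ ε : ℝ, 0 < ε ∧ ∃ Ω : ℝ, 0 < Ω ∧ ∃ N : ℕ,
      ∀ r : Fin m → ℝ, (∑ i, (r i - τ i) ^ 2) < ε ^ 2 → (∀ i, 0 < r i) →
        {ω : ℝ | IsSingularValue (Ttf E A0 A B C r (Complex.I * (ω : ℂ))) ξ}.Finite ∧
        {ω : ℝ | IsSingularValue (Ttf E A0 A B C r (Complex.I * (ω : ℂ))) ξ}.ncard < N ∧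
        ∀ ω : ℝ, IsSingularValue (Ttf E A0 A B C r (Complex.I * (ω : ℂ))) ξ → |ω| < Ω := by
  exact stmt9_aux n m n_w n_z ν E A0 A B C U V hν hU hV hUE hEV τ hτ hstrong hθ ξ hξ
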